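/- Gaussian average of a log-squared linear form: let v ∈ ℂ^d be nonzero. Then π^{−d} ∫_{ℂ^d} log(|v† z|²) e^{−z†z} dz = log(‖v‖²) − γ, where γ is the Euler–Mascheroni constant and the integral is with respect to Lebesgue measure on ℂ^d ≅ ℝ^{2d}. -/

import Mathlib

open MeasureTheory Matrix

/-- Integration in polar coordinates of a function of the squared modulus. -/
lemma integral_comp_normSq (g : ℝ → ℝ) :
    ∫ z : ℂ, g (Complex.normSq z) = Real.pi * ∫ t in Set.Ioi (0 : ℝ), g t := by
  calc
    _ = ∫ p in Set.Ioi (0 : ℝ) ×ˢ Set.Ioo (-Real.pi) Real.pi, p.1 * g (p.1 ^ 2) * 1 := by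
      rw [← Complex.integral_comp_polarCoord_symm, polarCoord_target]
      refine setIntegral_congr_fun (measurableSet_Ioi.prod measurableSet_Ioo) fun p _ => ?_
      simp [Complex.normSq_eq_norm_sq]
    _ = (∫ r in Set.Ioi (0 : ℝ), r * g (r ^ 2)) * ∫ _ in Set.Ioo (-Real.pi) Real.pi, (1 : ℝ) := by
      rw [← setIntegral_prod_mul, Measure.volume_eq_prod]
    _ = Real.pi * ∫ r in Set.Ioi (0 : ℝ), (2 * r ^ ((2 : ℝ) - 1)) • g (r ^ (2 : ℝ)) := by
      have h : ∀ r : ℝ, (2 * r ^ ((2 : ℝ) - 1)) • g (r ^ (2 : ℝ)) = 2 * (r * g (r ^ 2)) := by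
        intro r
        rw [show (2 : ℝ) - 1 = 1 by norm_num, Real.rpow_one, Real.rpow_two, smul_eq_mul, mul_assoc]
      simp_rw [h]
      rw [integral_const_mul]
      simp [Real.pi_pos.le]
      ring
    _ = _ := by rw [integral_comp_rpow_Ioi_of_pos two_pos]

lemma integral_log_mul_exp_neg :
    ∫ t in Set.Ioi (0 : ℝ), Real.log t * Real.exp (-t) = -Real.eulerMascheroniConstant := by
  have h := Complex.hasDerivAt_GammaIntegral (s := 1) (by simp)
  have h' : HasDerivAt Complex.GammaIntegral (-Real.eulerMascheroniConstant : ℂ) 1 := by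
    refine Complex.hasDerivAt_Gamma_one.congr_of_eventuallyEq ?_
    have : IsOpen {s : ℂ | 0 < s.re} := Complex.continuous_re.isOpen_preimage _ isOpen_Ioi
    filter_upwards [this.mem_nhds (show (1 : ℂ) ∈ {s : ℂ | 0 < s.re} by simp)] with a ha
    exact (Complex.Gamma_eq_integral ha).symm
  have e := h.unique h'
  simp only [sub_self, Complex.cpow_zero, one_mul, ← Complex.ofReal_mul] at e
  rw [integral_complex_ofReal] at e
  exact_mod_cast e

lemma integrableOn_log_mul_exp_neg :
    IntegrableOn (fun t : ℝ => Real.log t * Real.exp (-t)) (Set.Ioi 0) := by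
  refine Integrable.of_integral_ne_zero ?_
  rw [integral_log_mul_exp_neg]
  linarith [Real.one_half_lt_eulerMascheroniConstant]

lemma integral_exp_neg_normSq :
    ∫ z : ℂ, Real.exp (-Complex.normSq z) = Real.pi := by
  rw [integral_comp_normSq fun t => Real.exp (-t), integral_exp_neg_Ioi_zero, mul_one]

lemma integral_log_mul_exp_neg_normSq {c : ℝ} (hc : 0 < c) :
    ∫ z : ℂ, Real.log (c * Complex.normSq z) * Real.exp (-Complex.normSq z) =
      Real.pi * (Real.log c - Real.eulerMascheroniConstant) := by
  rw [integral_comp_normSq fun t => Real.log (c * t) * Real.exp (-t)]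
  have h : ∫ t in Set.Ioi (0 : ℝ), Real.log (c * t) * Real.exp (-t) =
      ∫ t in Set.Ioi (0 : ℝ), (Real.log c * Real.exp (-t) + Real.log t * Real.exp (-t)) := by
    refine setIntegral_congr_fun measurableSet_Ioi fun t ht => ?_
    rw [Real.log_mul hc.ne' (ne_of_gt ht), add_mul]
  rw [h, integral_add ((integrableOn_exp_neg_Ioi 0).const_mul _) integrableOn_log_mul_exp_neg,
    integral_const_mul, integral_exp_neg_Ioi_zero, integral_log_mul_exp_neg]
  ring

lemma integral_exp_neg_sum_normSq (ι : Type*) [Fintype ι] :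
    ∫ z : ι → ℂ, Real.exp (-∑ a, Complex.normSq (z a)) = Real.pi ^ Fintype.card ι := by
  simp_rw [← Finset.sum_neg_distrib, Real.exp_sum]
  rw [integral_fintype_prod_volume_eq_pow fun z : ℂ => Real.exp (-Complex.normSq z),
    integral_exp_neg_normSq]

lemma integral_log_coord {ι : Type*} [Fintype ι] (i : ι) {c : ℝ} (hc : 0 < c) :
    ∫ z : ι → ℂ, Real.log (c * Complex.normSq (z i)) * Real.exp (-∑ a, Complex.normSq (z a)) =
      Real.pi ^ Fintype.card ι * (Real.log c - Real.eulerMascheroniConstant) := by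
  classical
  let f : ι → ℂ → ℝ := fun a w =>
    (if a = i then Real.log (c * Complex.normSq w) else 1) * Real.exp (-Complex.normSq w)
  have h : ∀ z : ι → ℂ,
      Real.log (c * Complex.normSq (z i)) * Real.exp (-∑ a, Complex.normSq (z a)) =
      ∏ a, f a (z a) := by
    intro z
    simp only [f]
    rw [Finset.prod_mul_distrib, ← Real.exp_sum, Finset.sum_neg_distrib,
      Finset.prod_ite_eq' Finset.univ i fun a => Real.log (c * Complex.normSq (z a))]
    simp
  refine (integral_congr_ae (.of_forall h)).trans
    ((integral_fintype_prod_volume_eq_prod f).trans ?_)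
  have h2 : ∀ a : ι, (∫ w : ℂ, f a w) =
      Real.pi * if a = i then Real.log c - Real.eulerMascheroniConstant else 1 := by
    intro a
    simp only [f]
    split_ifs
    · exact integral_log_mul_exp_neg_normSq hc
    · simp [integral_exp_neg_normSq]
  simp_rw [h2, Finset.prod_mul_distrib]
  simp

/-- A real-linear automorphism preserving the Euclidean norm preserves Lebesgue measure. -/
lemma measurePreserving_of_sum_normSq {ι : Type*} [Fintype ι] (T : (ι → ℂ) ≃L[ℝ] (ι → ℂ))
    (hT : ∀ z, ∑ a, Complex.normSq (T z a) = ∑ a, Complex.normSq (z a)) :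
    MeasurePreserving T := by
  refine ⟨T.continuous.measurable, ?_⟩
  have hdet : LinearMap.det (T.toLinearEquiv : (ι → ℂ) →ₗ[ℝ] (ι → ℂ)) ≠ 0 :=
    T.toLinearEquiv.isUnit_det'.ne_zero
  have hmap := Measure.map_linearMap_addHaar_eq_smul_addHaar
    (volume : Measure (ι → ℂ)) hdet
  have hcoe : ⇑(T.toLinearEquiv : (ι → ℂ) →ₗ[ℝ] (ι → ℂ)) = T := rfl
  rw [hcoe] at hmap
  set c := |(LinearMap.det (T.toLinearEquiv : (ι → ℂ) →ₗ[ℝ] (ι → ℂ)))⁻¹|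
  have hgauss : ∫ z, Real.exp (-∑ a, Complex.normSq (z a)) ∂(Measure.map T volume) =
      ∫ z : ι → ℂ, Real.exp (-∑ a, Complex.normSq (z a)) := by
    refine (T.toHomeomorph.measurableEmbedding.integral_map _).trans ?_
    exact integral_congr_ae (.of_forall fun z => by simp [hT])
  rw [hmap, integral_smul_measure, integral_exp_neg_sum_normSq,
    ENNReal.toReal_ofReal (abs_nonneg _), smul_eq_mul] at hgauss
  have hc : c = 1 := (mul_eq_right₀ (pow_ne_zero _ Real.pi_ne_zero)).1 hgauss
  rw [hmap, hc, ENNReal.ofReal_one, one_smul]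

/-- Some unitary change of coordinates turns the functional `star v ⬝ᵥ ·` into a multiple of a
coordinate. -/
lemma exists_unitary_coord {ι : Type*} [Fintype ι] (v : ι → ℂ) (i : ι) (hv : v ≠ 0) :
    ∃ T : (ι → ℂ) ≃L[ℝ] (ι → ℂ),
      (∀ z, ∑ a, Complex.normSq (T z a) = ∑ a, Complex.normSq (z a)) ∧
      ∀ z, Complex.normSq (star v ⬝ᵥ z) =
        (∑ a, Complex.normSq (v a)) * Complex.normSq (T z i) := by
  set w : EuclideanSpace ℂ ι := WithLp.toLp 2 v with hw
  have hw0 : w ≠ 0 := by simpa [hw] using hv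
  have hn : (‖w‖ : ℂ) ≠ 0 := by simpa using hw0
  have hsum : ∀ x : EuclideanSpace ℂ ι, ∑ a, Complex.normSq (x a) = ‖x‖ ^ 2 := by
    intro x
    simp [EuclideanSpace.norm_sq_eq, Complex.normSq_eq_norm_sq]
  obtain ⟨b, hb⟩ := Orthonormal.exists_orthonormalBasis_extension_of_card_eq (𝕜 := ℂ)
    (E := EuclideanSpace ℂ ι) (ι := ι) (by simp)
    (v := fun _ => (‖w‖ : ℂ)⁻¹ • w) (s := {i}) (by
      refine ⟨fun _ => ?_, fun x y hxy => (hxy (Subsingleton.elim x y)).elim⟩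
      simp [norm_smul, hw0])
  have hbi : w = (‖w‖ : ℂ) • b i := by rw [hb i rfl, smul_inv_smul₀ hn]
  let e : EuclideanSpace ℂ ι ≃L[ℂ] (ι → ℂ) := PiLp.continuousLinearEquiv 2 ℂ fun _ : ι => ℂ
  refine ⟨((e.symm.trans b.repr.toContinuousLinearEquiv).trans e).restrictScalars ℝ, ?_, ?_⟩
  · intro z
    have h1 := hsum (b.repr (WithLp.toLp 2 z))
    rw [b.repr.norm_map, ← hsum] at h1
    exact h1
  · intro z
    have h1 : star v ⬝ᵥ z = ‖w‖ * b.repr (WithLp.toLp 2 z) i := by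
      have h2 : star v ⬝ᵥ z = inner ℂ w (WithLp.toLp 2 z) := by
        rw [EuclideanSpace.inner_eq_star_dotProduct, dotProduct_comm]
      rw [h2, b.repr_apply_apply]
      nth_rw 1 [hbi]
      rw [inner_smul_left, Complex.conj_ofReal]
    rw [h1, Complex.normSq_mul, Complex.normSq_ofReal, ← pow_two, ← hsum w]
    rfl

theorem stmt14 {d : ℕ} (v : Fin d → ℂ) (hv : v ≠ 0) :
    (Real.pi ^ d)⁻¹ *
        ∫ z : Fin d → ℂ,
          Real.log (Complex.normSq (star v ⬝ᵥ z)) *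
            Real.exp (-(∑ a, Complex.normSq (z a))) =
      Real.log (∑ a, Complex.normSq (v a)) - Real.eulerMascheroniConstant := by
  obtain ⟨i, hi⟩ := Function.ne_iff.1 hv
  obtain ⟨T, hT, hTi⟩ := exists_unitary_coord v i hv
  have hc : 0 < ∑ a, Complex.normSq (v a) :=
    Finset.sum_pos' (fun a _ => Complex.normSq_nonneg _)
      ⟨i, Finset.mem_univ i, Complex.normSq_pos.2 hi⟩
  have h := (measurePreserving_of_sum_normSq T hT).integral_comp
    T.toHomeomorph.measurableEmbedding fun z => Real.log ((∑ a, Complex.normSq (v a)) *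
      Complex.normSq (z i)) * Real.exp (-∑ a, Complex.normSq (z a))
  simp only [hT, ← hTi] at h
  rw [h, integral_log_coord i hc, Fintype.card_fin,
    inv_mul_cancel_left₀ (pow_ne_zero _ Real.pi_ne_zero)]
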